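/- arXiv:2504.09126 — 3 statements merged into one kernel-verified Lean document; each statement's English description precedes it below -/
import Mathlib

section
/- Let C be the R-submodule of R² generated by the single element (g11(x), g12(x)), where g11 divides x^m − 1. Let g = gcd(g11, g12), g11' = g11/g, and g22 = (x^m − 1)/g11'. Then: (1) C is also generated by the two elements (g11(x), g12(x) mod g22(x)) and (0, g22(x)) (where g12 mod g22 denotes the remainder of g12 upon division by g22), and these generators satisfy: g11 divides x^m − 1, g22 divides x^m − 1, deg(g12 mod g22) < deg g22, and g11·g22 divides (x^m − 1)·(g12 mod g22); (2) gcd(g11, g22) = g. -/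
open Polynomial

noncomputable section

/-- An integer coprime to the order of a finite field is nonzero in that field. -/
theorem natCast_ne_zero_of_coprime_card {F : Type*} [Field F] [Fintype F] {m : ℕ}
    (h : Nat.Coprime (Fintype.card F) m) : (m : F) ≠ 0 := by
  intro h0
  have hm : ringChar F ∣ m := (ringChar.spec F m).mp h0
  have hc : ringChar F ∣ Fintype.card F :=
    (ringChar.spec F _).mp (FiniteField.cast_card_eq_zero F)
  exact CharP.ringChar_ne_one (Nat.dvd_one.mp (h ▸ Nat.dvd_gcd hc hm))

/-- If `s • (a, b) = (0, d)`, then the submodule generated by `(a, b)` is also generated by `(0, d)`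
and the pair obtained from `(a, b)` by reducing `b` modulo `d`. -/
theorem span_singleton_prod_eq_span_pair {R : Type*} [CommRing R] {a b d k r s : R}
    (ha : s * a = 0) (hb : s * b = d) (hr : b = d * k + r) :
    Submodule.span R {(a, b)} = Submodule.span R {(a, r), ((0 : R), d)} := by
  apply le_antisymm
  · rw [Submodule.span_singleton_le_iff_mem, Submodule.mem_span_pair]
    refine ⟨1, k, ?_⟩
    ext <;> simp [hr]
    ring
  · rw [Submodule.span_le, Set.insert_subset_iff, Set.singleton_subset_iff]
    simp only [SetLike.mem_coe, Submodule.mem_span_singleton]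
    refine ⟨⟨1 - k * s, ?_⟩, s, ?_⟩
    · ext
      · simp only [Prod.smul_mk, smul_eq_mul]
        linear_combination -k * ha
      · simp only [Prod.smul_mk, smul_eq_mul]
        linear_combination -k * hb + hr
    · simp [ha, hb]

/-- A one-generator quasi-cyclic code generated by `(g11, g12)` with `g11 ∣ x^m - 1`
is also generated by `(g11, g12 mod g22)` and `(0, g22)` where
`g22 = (x^m - 1)/g11'`, `g11' = g11/gcd(g11,g12)`; these generators satisfy
Conditions (∗), and `gcd(g11, g22) = gcd(g11, g12)`. -/
theorem stmt2 (F : Type) [Field F] [Fintype F] [DecidableEq F] (m : ℕ) (hm : 0 < m)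
    (hqm : Nat.Coprime (Fintype.card F) m)
    (g11 g12 : F[X]) (h11 : g11 ∣ X ^ m - 1)
    (g g11' g22 : F[X]) (hg : g = gcd g11 g12) (h11' : g11' = g11 / g)
    (h22 : g22 = (X ^ m - 1) / g11') :
    (Submodule.span (AdjoinRoot (X ^ m - 1 : F[X]))
        {(AdjoinRoot.mk (X ^ m - 1 : F[X]) g11, AdjoinRoot.mk (X ^ m - 1 : F[X]) g12)} =
      Submodule.span (AdjoinRoot (X ^ m - 1 : F[X]))
        {(AdjoinRoot.mk (X ^ m - 1 : F[X]) g11, AdjoinRoot.mk (X ^ m - 1 : F[X]) (g12 % g22)),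
          (0, AdjoinRoot.mk (X ^ m - 1 : F[X]) g22)} ∧
      g11 ∣ X ^ m - 1 ∧ g22 ∣ X ^ m - 1 ∧ (g12 % g22).degree < g22.degree ∧
      g11 * g22 ∣ (X ^ m - 1) * (g12 % g22)) ∧
    gcd g11 g22 = g := by
  have hN : (X ^ m - 1 : F[X]).Separable :=
    X_pow_sub_one_separable_iff.mpr (natCast_ne_zero_of_coprime_card hqm)
  have hN0 : (X ^ m - 1 : F[X]) ≠ 0 := hN.ne_zero
  have hgn : normalize g = g := hg ▸ normalize_gcd g11 g12
  obtain ⟨a, b, ha, hb, hab⟩ := extract_gcd g11 g12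
  rw [← hg] at ha hb
  rw [gcd_isUnit_iff] at hab
  obtain ⟨h, hh⟩ := h11
  have hg0 : g ≠ 0 := by
    rintro rfl
    simp [hh, ha] at hN0
  have ha0 : a ≠ 0 := by
    rintro rfl
    simp [hh, ha] at hN0
  have hg11' : g11' = a := by
    rw [h11', ha, mul_div_cancel_left₀ _ hg0]
  have hg22 : g22 = g * h := by
    rw [h22, hg11', hh, ha, mul_comm g a, mul_assoc, mul_div_cancel_left₀ _ ha0]
  have hNa : (X ^ m - 1 : F[X]) = a * g22 := by
    rw [hh, ha, hg22]
    ring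
  have hg220 : g22 ≠ 0 := by
    rintro h0
    simp [hNa, h0] at hN0
  have hgr : g ∣ g12 % g22 :=
    (EuclideanDomain.dvd_mod_iff (hg22 ▸ dvd_mul_right g h)).mpr ⟨b, hb⟩
  refine ⟨⟨?_, ⟨h, hh⟩, ⟨a, by rw [hNa, mul_comm]⟩, EuclideanDomain.mod_lt _ hg220, ?_⟩, ?_⟩
  · obtain ⟨u, v, huv⟩ := hab
    have hmk : AdjoinRoot.mk (X ^ m - 1 : F[X]) a * AdjoinRoot.mk (X ^ m - 1 : F[X]) g22 = 0 := by
      rw [← map_mul, ← hNa, AdjoinRoot.mk_self]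
    refine span_singleton_prod_eq_span_pair (s := AdjoinRoot.mk (X ^ m - 1 : F[X]) (v * h))
      (k := AdjoinRoot.mk (X ^ m - 1 : F[X]) (g12 / g22)) ?_ ?_ ?_
    · have : v * h * g11 = v * (a * g22) := by
        rw [ha, hg22]
        ring
      rw [← map_mul, this, map_mul, map_mul, hmk, mul_zero]
    · have : v * h * g12 = g22 - u * (a * g22) := by
        rw [hb, hg22]
        linear_combination g * h * huv
      rw [← map_mul, this, map_sub, map_mul, map_mul, hmk, mul_zero, sub_zero]
    · rw [← map_mul, ← map_add, EuclideanDomain.div_add_mod]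
  · obtain ⟨c, hc⟩ := hgr
    exact ⟨c, by rw [hc, hNa, ha]; ring⟩
  · have hcop : IsCoprime a h := by
      refine IsCoprime.of_mul_right_right (y := g) ?_
      rw [← hg22]
      exact (hNa ▸ hN).isCoprime
    rw [ha, hg22, gcd_mul_left, hgn]
    have := normalize_gcd a h
    rw [normalize_eq_one.mpr ((gcd_isUnit_iff a h).mpr hcop)] at this
    rw [← this, mul_one]
end
end

section
/- If the code C is Euclidean LCD, then the polynomial l = (x^m − 1)/lcm(g11, g22) is self-reciprocal. -/
open Polynomial

noncomputable section

/-- The coefficient vector (of length `m`) of the canonical representative of an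
element of `R = F[x]/(x^m - 1)`.  Under the identification of `R²` with `F^{2m}` a pair
`(a(x), b(x))` corresponds to the concatenation of the two coefficient vectors. -/
def qcToVec {F : Type} [Field F] {m : ℕ} (hm : 0 < m)
    (a : AdjoinRoot (X ^ m - 1 : F[X])) : Fin m → F := fun i =>
  (AdjoinRoot.modByMonicHom
    (show (X ^ m - 1 : F[X]).Monic by
      simpa using monic_X_pow_sub_C (1 : F) hm.ne') a).coeff i

/-- The Euclidean inner product `⟨u,v⟩_e = Σ u_i v_i` on `R × R`, via the identification
of `R²` with `F^{2m}` by coefficient vectors. -/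
def qcEuclInner {F : Type} [Field F] {m : ℕ} (hm : 0 < m)
    (u v : AdjoinRoot (X ^ m - 1 : F[X]) × AdjoinRoot (X ^ m - 1 : F[X])) : F :=
  (∑ i, qcToVec hm u.1 i * qcToVec hm v.1 i) +
    ∑ i, qcToVec hm u.2 i * qcToVec hm v.2 i

/-- A code `C ⊆ R²` is LCD with respect to a pairing `inner` if it meets its dual
trivially, i.e. `C ∩ C^⊥ = {0}` where `C^⊥ = {v : ∀ c ∈ C, inner c v = 0}`. -/
def IsLCDWith {F : Type} [Field F] {m : ℕ}
    (Cd : Submodule (AdjoinRoot (X ^ m - 1 : F[X]))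
      (AdjoinRoot (X ^ m - 1 : F[X]) × AdjoinRoot (X ^ m - 1 : F[X])))
    (inner : (AdjoinRoot (X ^ m - 1 : F[X]) × AdjoinRoot (X ^ m - 1 : F[X])) →
      (AdjoinRoot (X ^ m - 1 : F[X]) × AdjoinRoot (X ^ m - 1 : F[X])) → F) : Prop :=
  ∀ v ∈ Cd, (∀ c ∈ Cd, inner c v = 0) → v = 0

/-- `f` is self-reciprocal: the reciprocal polynomial `f*(x) = x^(deg f)·f(1/x)` is a
nonzero scalar multiple of `f`. -/
def IsSelfReciprocal {F : Type} [Field F] (f : F[X]) : Prop :=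
  ∃ α : F, α ≠ 0 ∧ f.reverse = Polynomial.C α * f

section Conjugation

variable {F : Type} [Field F] {m : ℕ}

theorem root_pow_eq_one : AdjoinRoot.root (X ^ m - 1 : F[X]) ^ m = 1 := by
  have h := AdjoinRoot.mk_self (f := (X ^ m - 1 : F[X]))
  rw [map_sub, map_pow, map_one, AdjoinRoot.mk_X] at h
  exact sub_eq_zero.mp h

theorem root_pow_mod (k : ℕ) : AdjoinRoot.root (X ^ m - 1 : F[X]) ^ k =
    AdjoinRoot.root (X ^ m - 1 : F[X]) ^ (k % m) := by
  conv_lhs => rw [← Nat.div_add_mod k m, pow_add, pow_mul, root_pow_eq_one, one_pow, one_mul]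

/-- The conjugation `x ↦ x⁻¹ = x^(m-1)` of `F[x]/(x^m - 1)`. -/
def conj (F : Type) [Field F] (m : ℕ) :
    AdjoinRoot (X ^ m - 1 : F[X]) →ₐ[F] AdjoinRoot (X ^ m - 1 : F[X]) :=
  AdjoinRoot.liftAlgHom _ (Algebra.ofId _ _) (AdjoinRoot.root (X ^ m - 1 : F[X]) ^ (m - 1)) (by
    have h : (AdjoinRoot.root (X ^ m - 1 : F[X]) ^ (m - 1)) ^ m = 1 := by
      rw [pow_right_comm, root_pow_eq_one, one_pow]
    simp [h])

@[simp]
theorem conj_root : conj F m (AdjoinRoot.root _) = AdjoinRoot.root _ ^ (m - 1) := by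
  simp [conj]

theorem root_mul_conj_root (hm : 0 < m) :
    AdjoinRoot.root (X ^ m - 1 : F[X]) * conj F m (AdjoinRoot.root _) = 1 := by
  rw [conj_root, ← pow_succ', Nat.sub_add_cancel hm, root_pow_eq_one]

theorem conj_conj (hm : 0 < m) (a : AdjoinRoot (X ^ m - 1 : F[X])) :
    conj F m (conj F m a) = a := by
  have h : (conj F m).comp (conj F m) = AlgHom.id F _ := by
    refine AdjoinRoot.algHom_ext ?_
    have h1 := root_mul_conj_root (F := F) hm
    have h2 := congrArg (conj F m) h1
    rw [map_mul, map_one] at h2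
    rw [AlgHom.comp_apply, AlgHom.id_apply]
    calc _ = (AdjoinRoot.root (X ^ m - 1 : F[X]) * conj F m (AdjoinRoot.root _)) *
          conj F m (conj F m (AdjoinRoot.root _)) := by rw [h1, one_mul]
      _ = _ := by rw [mul_assoc, h2, mul_one]
  exact DFunLike.congr_fun h a

theorem mk_reverse (hm : 0 < m) (f : F[X]) :
    AdjoinRoot.mk (X ^ m - 1 : F[X]) f.reverse =
      AdjoinRoot.root _ ^ f.natDegree * conj F m (AdjoinRoot.mk _ f) := by
  have h1 := root_mul_conj_root (F := F) hm
  let _ : Invertible (conj F m (AdjoinRoot.root (X ^ m - 1 : F[X]))) :=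
    ⟨AdjoinRoot.root _, h1, by rw [mul_comm, h1]⟩
  have h : aeval (AdjoinRoot.root (X ^ m - 1 : F[X])) f.reverse *
      conj F m (AdjoinRoot.root _) ^ f.natDegree = aeval (conj F m (AdjoinRoot.root _)) f :=
    eval₂_reverse_mul_pow (algebraMap F (AdjoinRoot (X ^ m - 1 : F[X])))
      (conj F m (AdjoinRoot.root _)) f
  rw [aeval_algHom_apply, AdjoinRoot.aeval_eq, AdjoinRoot.aeval_eq] at h
  rw [← h, mul_left_comm, ← mul_pow, h1, one_pow, mul_one]

theorem modByMonicHom_root_pow (hm : 0 < m) (hP : (X ^ m - 1 : F[X]).Monic) {k : ℕ} (hk : k < m) :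
    AdjoinRoot.modByMonicHom hP (AdjoinRoot.root (X ^ m - 1 : F[X]) ^ k) = X ^ k := by
  rw [← AdjoinRoot.mk_X, ← map_pow, AdjoinRoot.modByMonicHom_mk, modByMonic_eq_self_iff hP,
    degree_X_pow, ← C_1, degree_X_pow_sub_C hm]
  exact_mod_cast hk

theorem eq_sum_qcToVec (hm : 0 < m) (a : AdjoinRoot (X ^ m - 1 : F[X])) :
    a = ∑ i : Fin m, qcToVec hm a i • AdjoinRoot.root (X ^ m - 1 : F[X]) ^ (i : ℕ) := by
  have hP : (X ^ m - 1 : F[X]).Monic := by simpa using monic_X_pow_sub_C (1 : F) hm.ne'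
  have hd : (AdjoinRoot.modByMonicHom hP a).natDegree < m := by
    obtain ⟨f, rfl⟩ := AdjoinRoot.mk_surjective a
    rw [AdjoinRoot.modByMonicHom_mk]
    have := natDegree_modByMonic_lt f hP (by
      intro h
      have := congrArg natDegree h
      rw [← C_1, natDegree_X_pow_sub_C, natDegree_C] at this
      omega)
    rwa [← C_1, natDegree_X_pow_sub_C] at this
  conv_lhs => rw [← AdjoinRoot.mk_leftInverse hP a, as_sum_range' _ m hd, map_sum,
    Finset.sum_range]
  refine Finset.sum_congr rfl fun i _ => ?_
  rw [← smul_X_eq_monomial, ← AdjoinRoot.smul_mk, map_pow, AdjoinRoot.mk_X]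
  rfl

theorem sum_qcToVec_mul (hm : 0 < m) (a b : AdjoinRoot (X ^ m - 1 : F[X])) :
    ∑ i, qcToVec hm a i * qcToVec hm b i = qcToVec hm (a * conj F m b) ⟨0, hm⟩ := by
  have hP : (X ^ m - 1 : F[X]).Monic := by simpa using monic_X_pow_sub_C (1 : F) hm.ne'
  have key (i j : Fin m) : (AdjoinRoot.modByMonicHom hP
      (AdjoinRoot.root (X ^ m - 1 : F[X]) ^ (i : ℕ) * (AdjoinRoot.root _ ^ (m - 1)) ^ (j : ℕ))).coeff 0 =
      if i = j then 1 else 0 := by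
    rw [← pow_mul, ← pow_add, root_pow_mod, modByMonicHom_root_pow hm hP (Nat.mod_lt _ hm),
      coeff_X_pow]
    refine if_congr ?_ rfl rfl
    rw [eq_comm, ← Nat.dvd_iff_mod_eq_zero, Fin.ext_iff]
    zify [show 1 ≤ m from hm]
    have : (i : ℤ) + (m - 1) * j = (i - j) + m * j := by ring
    rw [this, dvd_add_left (dvd_mul_right _ _)]
    constructor
    · intro h
      have := Int.eq_zero_of_abs_lt_dvd h (by rw [abs_lt]; omega)
      omega
    · intro h
      simp [h]
  conv_rhs => rw [eq_sum_qcToVec hm a, eq_sum_qcToVec hm b]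
  simp only [qcToVec, map_sum, map_smul, map_pow, conj_root, Finset.sum_mul_sum, finsetSum_coeff,
    smul_mul_smul_comm, coeff_smul, key]
  simp

theorem qcEuclInner_eq_zero (hm : 0 < m)
    {u v : AdjoinRoot (X ^ m - 1 : F[X]) × AdjoinRoot (X ^ m - 1 : F[X])}
    (h : u.1 * conj F m v.1 + u.2 * conj F m v.2 = 0) : qcEuclInner hm u v = 0 := by
  rw [qcEuclInner, sum_qcToVec_mul, sum_qcToVec_mul]
  simp only [qcToVec]
  rw [← coeff_add, ← map_add, h, map_zero, coeff_zero]

end Conjugation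

theorem reverse_X_pow_sub_one {F : Type} [Field F] {m : ℕ} :
    (X ^ m - 1 : F[X]).reverse = -(X ^ m - 1) := by
  have hd : (X ^ m - 1 : F[X]).natDegree = m := by rw [← C_1, natDegree_X_pow_sub_C]
  rw [reverse, hd, reflect_sub, reflect_one, reflect_monomial, revAt_le le_rfl, Nat.sub_self]
  simp

theorem isSelfReciprocal_of_reverse_dvd {F : Type} [Field F] {f : F[X]} (hf : f.coeff 0 ≠ 0)
    (h : f.reverse ∣ f) : IsSelfReciprocal f := by
  have h0 : f ≠ 0 := by rintro rfl; simp at hf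
  obtain ⟨c, hc⟩ := associated_of_dvd_of_natDegree_le h h0 (by
    rw [reverse_natDegree, natTrailingDegree_eq_zero.mpr (Or.inr hf), Nat.sub_zero])
  obtain ⟨r, hr, hrc⟩ := Polynomial.isUnit_iff.mp c.isUnit
  refine ⟨r⁻¹, inv_ne_zero hr.ne_zero, ?_⟩
  conv_rhs => rw [← hc, ← hrc]
  rw [mul_left_comm, ← C_mul, inv_mul_cancel₀ hr.ne_zero, C_1, mul_one]


/-- If the quasi-cyclic code `C = ⟨(g11, g12), (0, g22)⟩` is Euclidean LCD, then
`l = (x^m - 1)/lcm(g11, g22)` is self-reciprocal. -/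
theorem stmt5 (F : Type) [Field F] [Fintype F] [DecidableEq F] (m : ℕ) (hm : 0 < m)
    (hqm : Nat.Coprime (Fintype.card F) m)
    (g11 g12 g22 : F[X])
    (h1 : g11 ∣ X ^ m - 1) (h2 : g22 ∣ X ^ m - 1)
    (h3 : g12.degree < g22.degree) (h4 : g11 * g22 ∣ (X ^ m - 1) * g12)
    (hlcd : IsLCDWith
      (Submodule.span (AdjoinRoot (X ^ m - 1 : F[X]))
        {(AdjoinRoot.mk (X ^ m - 1 : F[X]) g11, AdjoinRoot.mk (X ^ m - 1 : F[X]) g12), (0, AdjoinRoot.mk (X ^ m - 1 : F[X]) g22)})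
      (qcEuclInner hm)) :
    IsSelfReciprocal ((X ^ m - 1) / lcm g11 g22) := by
  set P : F[X] := X ^ m - 1 with hPdef
  have hsep : P.Separable := by
    rw [hPdef, X_pow_sub_one_separable_iff]
    have := hqm.cast (R := F)
    rw [FiniteField.cast_card_eq_zero, isCoprime_zero_left] at this
    exact this.ne_zero
  have hP0 : P ≠ 0 := hsep.ne_zero
  set L := lcm g11 g22 with hL
  obtain ⟨l, hl⟩ : L ∣ P := lcm_dvd h1 h2
  have hL0 : L ≠ 0 := by rintro h; simp [h] at hl; exact hP0 hl
  obtain ⟨a, ha⟩ : g11 ∣ L := dvd_lcm_left _ _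
  obtain ⟨b, hb⟩ : g22 ∣ L := dvd_lcm_right _ _
  have h110 : g11 ≠ 0 := by rintro h; simp [h] at ha; exact hL0 ha
  have h220 : g22 ≠ 0 := by rintro h; simp [h] at hb; exact hL0 hb
  have hdiv : P / L = l := by rw [hl, mul_div_cancel_left₀ _ hL0]
  rw [hdiv]
  have hLl : IsCoprime L l := by rw [hl] at hsep; exact hsep.isCoprime
  obtain ⟨t, ht⟩ : g22 ∣ a * g12 := by
    have : g22 ∣ l * (a * g12) := by
      rw [hl, ha] at h4
      refine (mul_dvd_mul_iff_left h110).mp (h4.trans (dvd_of_eq (by ring)))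
    exact (hLl.of_isCoprime_of_dvd_left ⟨b, hb⟩).dvd_of_dvd_mul_left this
  -- `L` maps the whole of `R²` into the code.
  have hmem (s r : AdjoinRoot P) : (AdjoinRoot.mk P L * s, AdjoinRoot.mk P L * r) ∈
      Submodule.span (AdjoinRoot P) {(AdjoinRoot.mk P g11, AdjoinRoot.mk P g12),
        (0, AdjoinRoot.mk P g22)} := by
    refine Submodule.mem_span_pair.mpr ⟨AdjoinRoot.mk P a * s,
      AdjoinRoot.mk P b * r - AdjoinRoot.mk P t * s, ?_⟩
    have ht' := congrArg (AdjoinRoot.mk P) ht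
    have ha' := congrArg (AdjoinRoot.mk P) ha
    have hb' := congrArg (AdjoinRoot.mk P) hb
    simp only [map_mul] at ht' ha' hb'
    ext
    · simp only [Prod.smul_mk, Prod.mk_add_mk, smul_eq_mul]
      linear_combination (-s) * ha'
    · simp only [Prod.smul_mk, Prod.mk_add_mk, smul_eq_mul]
      linear_combination (-r) * hb' + s * ht'
  -- A vector of `L • R²` orthogonal to both generators vanishes, so `l*` divides its conjugate.
  have hzero (s r : F[X])
      (hs : P ∣ g11 * s + g12 * r) (hr : P ∣ g22 * r) : l.reverse ∣ s ∧ l.reverse ∣ r := by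
    have hs' := AdjoinRoot.mk_eq_zero.mpr hs
    have hr' := AdjoinRoot.mk_eq_zero.mpr hr
    simp only [map_add, map_mul] at hs' hr'
    have hv := hlcd _ (hmem (conj F m (AdjoinRoot.mk P s)) (conj F m (AdjoinRoot.mk P r))) (by
      intro c hc
      obtain ⟨x, y, rfl⟩ := Submodule.mem_span_pair.mp hc
      apply qcEuclInner_eq_zero
      simp only [Prod.smul_mk, Prod.mk_add_mk, smul_eq_mul, map_mul]
      rw [conj_conj hm, conj_conj hm]
      linear_combination (conj F m (AdjoinRoot.mk P L)) * (x * hs' + y * hr'))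
    have hLrev : L.reverse ≠ 0 := by rwa [Ne, reverse_eq_zero]
    have hPrev : L.reverse * l.reverse ∣ P := by
      rw [← reverse_mul_of_domain, ← hl, hPdef, reverse_X_pow_sub_one]
      exact neg_dvd.mpr dvd_rfl
    have aux (p : F[X]) (hp : AdjoinRoot.mk P L * conj F m (AdjoinRoot.mk P p) = 0) :
        l.reverse ∣ p := by
      have := congrArg (conj F m) hp
      rw [map_mul, conj_conj hm, map_zero] at this
      refine (mul_dvd_mul_iff_left hLrev).mp (hPrev.trans (AdjoinRoot.mk_eq_zero.mp ?_))
      rw [map_mul, mk_reverse hm, mul_assoc, this, mul_zero]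
    exact ⟨aux s (congrArg Prod.fst hv), aux r (congrArg Prod.snd hv)⟩
  have hP11 : P = g11 * (a * l) := by rw [hl, ha]; ring
  have hP22 : P = g22 * (b * l) := by rw [hl, hb]; ring
  have hd1 : l.reverse ∣ a * l := (hzero (a * l) 0 (by simp [← hP11]) (by simp)).1
  have hd2 : l.reverse ∣ (b * l) * g11 :=
    (hzero (-(b * l) * g12) ((b * l) * g11) ⟨0, by ring⟩ ⟨g11, by rw [hP22]; ring⟩).2
  have hcop : IsCoprime g11 l.reverse := by
    have : IsCoprime g11 (a * l) := by rw [hP11] at hsep; exact hsep.isCoprime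
    exact this.of_isCoprime_of_dvd_right hd1
  have hd3 : l.reverse ∣ b * l := hcop.symm.dvd_of_dvd_mul_right hd2
  obtain ⟨k, hk⟩ : l.reverse ∣ P := hd1.trans ⟨g11, by rw [hP11]; ring⟩
  have hl0 : l.reverse ≠ 0 := by rintro h; simp [h] at hk; exact hP0 hk
  have hLk : L ∣ k := by
    refine lcm_dvd ?_ ?_
    · refine (mul_dvd_mul_iff_left hl0).mp ?_
      rw [← hk, hP11, mul_comm]; exact mul_dvd_mul_left _ hd1
    · refine (mul_dvd_mul_iff_left hl0).mp ?_
      rw [← hk, hP22, mul_comm]; exact mul_dvd_mul_left _ hd3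
  refine isSelfReciprocal_of_reverse_dvd ?_ ?_
  · intro h
    have := congrArg (coeff · 0) hl
    simp [mul_coeff_zero, h, hPdef, hm.ne] at this
  · refine (mul_dvd_mul_iff_left hL0).mp ?_
    rw [← hl, hk, mul_comm]
    exact mul_dvd_mul_left _ hLk
end
end

section
/- The code C is symplectic LCD if and only if all of the following four conditions hold: (I) g is self-reciprocal; (II) l is self-reciprocal; (III) r11(x) = 1 (i.e., r11 is a nonzero constant); (IV) gcd(r22(x), g11(x)·ḡ12(x) − g12(x)·ḡ11(x)) = 1. -/
open Polynomial

noncomputable section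

/-- The symplectic inner product on `R × R`: writing vectors of `F^{2m}` as `(x1 | x2)`,
`⟨(x1|x2),(y1|y2)⟩_s = ⟨x1,y2⟩_e - ⟨x2,y1⟩_e`. -/
def qcSympInner {F : Type} [Field F] {m : ℕ} (hm : 0 < m)
    (u v : AdjoinRoot (X ^ m - 1 : F[X]) × AdjoinRoot (X ^ m - 1 : F[X])) : F :=
  (∑ i, qcToVec hm u.1 i * qcToVec hm v.2 i) -
    ∑ i, qcToVec hm u.2 i * qcToVec hm v.1 i

section RootsOfUnity

variable {F : Type} [Field F] {m : ℕ} {K : Type} [Field K] [Algebra F K]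

theorem aeval_eq_zero_of_dvd {p q : F[X]} (h : p ∣ q) {x : K} (hp : aeval x p = 0) :
    aeval x q = 0 := by
  obtain ⟨r, rfl⟩ := h
  simp [hp]

theorem aeval_X_pow_sub_one_eq_zero_iff {x : K} :
    aeval x (X ^ m - 1 : F[X]) = 0 ↔ x ^ m = 1 := by
  simp [sub_eq_zero]

theorem aeval_gcd_eq_zero_iff [DecidableEq F] {p q : F[X]} {x : K} :
    aeval x (gcd p q) = 0 ↔ aeval x p = 0 ∧ aeval x q = 0 := by
  refine ⟨fun h => ⟨aeval_eq_zero_of_dvd (gcd_dvd_left p q) h,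
    aeval_eq_zero_of_dvd (gcd_dvd_right p q) h⟩, fun h => ?_⟩
  exact aeval_eq_zero_of_dvd (dvd_gcd (minpoly.dvd F x h.1) (minpoly.dvd F x h.2))
    (minpoly.aeval F x)

theorem aeval_lcm_eq_zero_iff [DecidableEq F] {p q : F[X]} {x : K} :
    aeval x (lcm p q) = 0 ↔ aeval x p = 0 ∨ aeval x q = 0 := by
  refine ⟨fun h => ?_, fun h => ?_⟩
  · have := aeval_eq_zero_of_dvd (lcm_dvd (dvd_mul_right p q) (dvd_mul_left q p)) h
    simpa using this
  · exact h.elim (aeval_eq_zero_of_dvd (dvd_lcm_left p q))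
      (aeval_eq_zero_of_dvd (dvd_lcm_right p q))

/-- The two factors of a separable product have no common root, so the roots of one factor
are the roots of the product that are not roots of the other factor. -/
theorem Polynomial.Separable.aeval_left_eq_zero_iff {p q : F[X]} (h : (p * q).Separable) {x : K} :
    aeval x p = 0 ↔ aeval x (p * q) = 0 ∧ aeval x q ≠ 0 := by
  have := aeval_ne_zero_of_isCoprime h.isCoprime x
  rw [map_mul, mul_eq_zero]
  tauto

theorem Polynomial.Separable.dvd_of_forall_aeval [IsAlgClosed K] {p q : F[X]} (h : p.Separable)
    (hpq : ∀ x : K, aeval x p = 0 → aeval x q = 0) : p ∣ q := by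
  classical
  obtain ⟨r, hr⟩ := gcd_dvd_left p q
  have hsep := hr ▸ h
  have hunit : IsUnit r := by
    rw [← isCoprime_self, isCoprime_iff_aeval_ne_zero_of_isAlgClosed F K]
    intro x
    by_contra! hx
    have hp : aeval x p = 0 := by rw [hr, map_mul, hx.1, mul_zero]
    rcases aeval_ne_zero_of_isCoprime hsep.isCoprime x with h' | h'
    · exact h' (aeval_gcd_eq_zero_iff.2 ⟨hp, hpq x hp⟩)
    · exact h' hx.1
  exact hr.dvd.trans (hunit.mul_right_dvd.2 (gcd_dvd_right p q))

theorem aeval_reflect_eq {p : F[X]} {N : ℕ} (hp : p.natDegree ≤ N) {x : K} (hx : x ≠ 0) :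
    aeval x (reflect N p) = x ^ N * aeval x⁻¹ p := by
  let _ := invertibleOfNonzero (inv_ne_zero hx)
  have h := eval₂_reflect_mul_pow (algebraMap F K) x⁻¹ N p hp
  simp only [invOf_eq_inv, inv_inv] at h
  rw [aeval_def, aeval_def, ← h, mul_comm, mul_assoc, ← mul_pow, inv_mul_cancel₀ hx, one_pow,
    mul_one]

theorem aeval_reverse_eq_zero_iff {p : F[X]} {x : K} (hx : x ≠ 0) :
    aeval x p.reverse = 0 ↔ aeval x⁻¹ p = 0 := by
  rw [reverse, aeval_reflect_eq le_rfl hx]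
  simp [hx]

theorem isSelfReciprocal_iff_forall_aeval [IsAlgClosed K] {p : F[X]} (hp : p.Separable)
    (h0 : p.coeff 0 ≠ 0) :
    IsSelfReciprocal p ↔ ∀ x : K, aeval x p = 0 → aeval x⁻¹ p = 0 := by
  have hne : ∀ x : K, aeval x p = 0 → x ≠ 0 := by
    rintro x hx rfl
    exact h0 (by simpa [← coeff_zero_eq_aeval_zero'] using hx)
  constructor
  · rintro ⟨α, -, h⟩ x hx
    rw [← aeval_reverse_eq_zero_iff (hne x hx), h, map_mul, hx, mul_zero]
  · intro h
    obtain ⟨u, hu⟩ := hp.dvd_of_forall_aeval (K := K) (q := p.reverse)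
      fun x hx => (aeval_reverse_eq_zero_iff (hne x hx)).2 (h x hx)
    have hp0 : p ≠ 0 := hp.ne_zero
    have hu0 : u ≠ 0 := by
      rintro rfl
      exact hp0 (by simpa using hu)
    have hdeg : u.natDegree = 0 := by
      have h1 := natDegree_mul hp0 hu0
      have h2 := reverse_natDegree_le p
      rw [hu] at h2
      omega
    obtain ⟨c, rfl⟩ := natDegree_eq_zero.1 hdeg
    exact ⟨c, by simpa using hu0, by rw [hu, mul_comm]⟩

theorem exists_eq_C_iff_forall_aeval_ne_zero [IsAlgClosed K] {p : F[X]} :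
    (∃ c : F, c ≠ 0 ∧ p = C c) ↔ ∀ x : K, aeval x p ≠ 0 := by
  have := isCoprime_iff_aeval_ne_zero_of_isAlgClosed F K p p
  rw [isCoprime_self, isUnit_iff] at this
  simpa [isUnit_iff_ne_zero, eq_comm] using this

section Fourier

theorem IsPrimitiveRoot.sum_pow_mul_inv_pow {ζ : K} (hζ : IsPrimitiveRoot ζ m) (i k : Fin m) :
    ∑ j : Fin m, (ζ ^ (j : ℕ)) ^ (i : ℕ) * ((ζ ^ (j : ℕ))⁻¹) ^ (k : ℕ) =
      if i = k then (m : K) else 0 := by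
  have hm : m ≠ 0 := i.pos.ne'
  have hζ0 : ζ ≠ 0 := hζ.ne_zero hm
  set ω : K := ζ ^ (i : ℕ) * (ζ⁻¹) ^ (k : ℕ) with hω
  have hterm : ∀ j : Fin m,
      (ζ ^ (j : ℕ)) ^ (i : ℕ) * ((ζ ^ (j : ℕ))⁻¹) ^ (k : ℕ) = ω ^ (j : ℕ) := by
    intro j
    rw [hω, mul_pow, ← inv_pow, ← pow_mul, ← pow_mul, ← pow_mul, ← pow_mul, mul_comm (j : ℕ),
      mul_comm (j : ℕ)]
  simp_rw [hterm]
  rw [Fin.sum_univ_eq_sum_range (fun j => ω ^ j) m]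
  split_ifs with h
  · have : ω = 1 := by rw [hω, h, inv_pow, mul_inv_cancel₀ (pow_ne_zero _ hζ0)]
    simp [this]
  · have hω1 : ω ≠ 1 := by
      intro h1
      apply h
      rw [hω, inv_pow, mul_inv_eq_one₀ (pow_ne_zero _ hζ0)] at h1
      exact Fin.ext (hζ.pow_inj i.2 k.2 h1)
    have hωm : ω ^ m = 1 := by
      rw [hω, mul_pow, pow_right_comm ζ, pow_right_comm ζ⁻¹, inv_pow, hζ.pow_eq_one]
      simp
    have := mul_neg_geom_sum ω m
    rw [hωm, sub_self] at this
    exact (mul_eq_zero.1 this).resolve_left (sub_ne_zero.2 hω1.symm)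

theorem aeval_eq_sum_qcToVec (hm : 0 < m) (a : F[X]) {x : K} (hx : x ^ m = 1) :
    aeval x a =
      ∑ i, algebraMap F K (qcToVec hm (AdjoinRoot.mk (X ^ m - 1 : F[X]) a) i) * x ^ (i : ℕ) := by
  have hmon : (X ^ m - 1 : F[X]).Monic := by simpa using monic_X_pow_sub_C (1 : F) hm.ne'
  have hdeg : (X ^ m - 1 : F[X]).natDegree = m := by
    simpa using natDegree_X_pow_sub_C (n := m) (r := (1 : F))
  have hlt : (a %ₘ (X ^ m - 1)).natDegree < m := by
    have h1 : (X ^ m - 1 : F[X]) ≠ 1 := fun h => by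
      rw [h, natDegree_one] at hdeg
      omega
    simpa [hdeg] using natDegree_modByMonic_lt a hmon h1
  have h1 : aeval x a = aeval x (a %ₘ (X ^ m - 1)) := by
    conv_lhs => rw [← modByMonic_add_div a (X ^ m - 1)]
    simp [hx]
  rw [h1, aeval_eq_sum_range' hlt, ← Fin.sum_univ_eq_sum_range
    (fun i => (a %ₘ (X ^ m - 1)).coeff i • x ^ i) m]
  simp [qcToVec, Algebra.smul_def]

theorem IsPrimitiveRoot.card_mul_sum_qcToVec_mul {ζ : K} (hζ : IsPrimitiveRoot ζ m) (hm : 0 < m)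
    (a b : F[X]) :
    (m : K) * algebraMap F K (∑ i, qcToVec hm (AdjoinRoot.mk (X ^ m - 1 : F[X]) a) i *
      qcToVec hm (AdjoinRoot.mk (X ^ m - 1 : F[X]) b) i) =
      ∑ j : Fin m, aeval (ζ ^ (j : ℕ)) a * aeval (ζ ^ (j : ℕ))⁻¹ b := by
  have hpow : ∀ j : ℕ, (ζ ^ j) ^ m = 1 := fun j => by
    rw [← pow_mul, mul_comm, pow_mul, hζ.pow_eq_one, one_pow]
  have h : ∀ j : Fin m, aeval (ζ ^ (j : ℕ)) a * aeval (ζ ^ (j : ℕ))⁻¹ b = ∑ i, ∑ k,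
      (algebraMap F K (qcToVec hm (AdjoinRoot.mk (X ^ m - 1 : F[X]) a) i) *
        algebraMap F K (qcToVec hm (AdjoinRoot.mk (X ^ m - 1 : F[X]) b) k)) *
        ((ζ ^ (j : ℕ)) ^ (i : ℕ) * ((ζ ^ (j : ℕ))⁻¹) ^ (k : ℕ)) := by
    intro j
    rw [aeval_eq_sum_qcToVec hm a (hpow j),
      aeval_eq_sum_qcToVec hm b (x := (ζ ^ (j : ℕ))⁻¹) (by rw [inv_pow, hpow, inv_one]),
      Finset.sum_mul_sum]
    exact Finset.sum_congr rfl fun i _ => Finset.sum_congr rfl fun k _ => by ring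
  simp_rw [h]
  rw [Finset.sum_comm, map_sum, Finset.mul_sum]
  refine Finset.sum_congr rfl fun i _ => ?_
  rw [Finset.sum_comm]
  simp_rw [← Finset.mul_sum, hζ.sum_pow_mul_inv_pow]
  simp [mul_comm]

theorem IsPrimitiveRoot.card_mul_qcSympInner {ζ : K} (hζ : IsPrimitiveRoot ζ m) (hm : 0 < m)
    (a b c d : F[X]) :
    (m : K) * algebraMap F K (qcSympInner hm
      (AdjoinRoot.mk (X ^ m - 1 : F[X]) a, AdjoinRoot.mk (X ^ m - 1 : F[X]) b)
      (AdjoinRoot.mk (X ^ m - 1 : F[X]) c, AdjoinRoot.mk (X ^ m - 1 : F[X]) d)) =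
      ∑ j : Fin m, (aeval (ζ ^ (j : ℕ)) a * aeval (ζ ^ (j : ℕ))⁻¹ d -
        aeval (ζ ^ (j : ℕ)) b * aeval (ζ ^ (j : ℕ))⁻¹ c) := by
  rw [qcSympInner, map_sub, mul_sub, hζ.card_mul_sum_qcToVec_mul, hζ.card_mul_sum_qcToVec_mul,
    Finset.sum_sub_distrib]

/-- A pair is orthogonal to all multiples of `(a, b)` iff the symplectic pairing vanishes
pointwise at the `m`-th roots of unity. -/
theorem IsPrimitiveRoot.forall_qcSympInner_mul_eq_zero_iff {ζ : K} (hζ : IsPrimitiveRoot ζ m)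
    (hm : 0 < m) (hmK : (m : K) ≠ 0) (a b c d : F[X]) :
    (∀ p : F[X], qcSympInner hm
      (AdjoinRoot.mk (X ^ m - 1 : F[X]) (p * a), AdjoinRoot.mk (X ^ m - 1 : F[X]) (p * b))
      (AdjoinRoot.mk (X ^ m - 1 : F[X]) c, AdjoinRoot.mk (X ^ m - 1 : F[X]) d) = 0) ↔
      ∀ x : K, x ^ m = 1 → aeval x⁻¹ a * aeval x d = aeval x⁻¹ b * aeval x c := by
  have hpow : ∀ j : ℕ, (ζ ^ j) ^ m = 1 := fun j => by
    rw [← pow_mul, mul_comm, pow_mul, hζ.pow_eq_one, one_pow]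
  constructor
  · intro h x hx
    have hinj : Function.Injective fun j : Fin m => ζ ^ (j : ℕ) := fun i j hij =>
      Fin.ext (hζ.pow_inj i.2 j.2 hij)
    have hv := Matrix.eq_zero_of_forall_pow_sum_mul_pow_eq_zero hinj
      (v := fun j : Fin m => aeval (ζ ^ (j : ℕ)) a * aeval (ζ ^ (j : ℕ))⁻¹ d -
        aeval (ζ ^ (j : ℕ)) b * aeval (ζ ^ (j : ℕ))⁻¹ c) fun i => by
      have := hζ.card_mul_qcSympInner hm (X ^ (i : ℕ) * a) (X ^ (i : ℕ) * b) c d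
      rw [h, map_zero, mul_zero] at this
      rw [this]
      exact Finset.sum_congr rfl fun j _ => by
        simp only [map_mul, map_pow, aeval_X]
        ring
    have : NeZero m := NeZero.of_pos hm
    obtain ⟨j, hj, hxj⟩ := hζ.eq_pow_of_pow_eq_one (ξ := x⁻¹) (by rw [inv_pow, hx, inv_one])
    have := congrFun hv ⟨j, hj⟩
    simp only [hxj, inv_inv, Pi.zero_apply] at this
    exact sub_eq_zero.1 this
  · intro h p
    have := hζ.card_mul_qcSympInner hm (p * a) (p * b) c d
    rw [Finset.sum_eq_zero] at this
    · simpa [hmK] using this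
    · intro j _
      have := h (ζ ^ (j : ℕ))⁻¹ (by rw [inv_pow, hpow, inv_one])
      rw [inv_inv] at this
      simp only [map_mul]
      linear_combination aeval (ζ ^ (j : ℕ)) p * this

end Fourier

theorem mem_span_pair_mk_iff (N g11 g12 g22 : F[X]) (v : AdjoinRoot N × AdjoinRoot N) :
    v ∈ Submodule.span (AdjoinRoot N)
      {(AdjoinRoot.mk N g11, AdjoinRoot.mk N g12), (0, AdjoinRoot.mk N g22)} ↔
      ∃ p q : F[X], v = (AdjoinRoot.mk N (p * g11), AdjoinRoot.mk N (p * g12 + q * g22)) := by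
  rw [Submodule.mem_span_pair]
  constructor
  · rintro ⟨a, b, rfl⟩
    obtain ⟨p, rfl⟩ := AdjoinRoot.mk_surjective a
    obtain ⟨q, rfl⟩ := AdjoinRoot.mk_surjective b
    exact ⟨p, q, by simp⟩
  · rintro ⟨p, q, rfl⟩
    exact ⟨AdjoinRoot.mk N p, AdjoinRoot.mk N q, by simp⟩

/-- The symplectic LCD property can be checked separately at each `m`-th root of unity. -/
theorem isLCDWith_qcSympInner_iff_forall_aeval [IsAlgClosed K] {ζ : K} (hζ : IsPrimitiveRoot ζ m)
    (hm : 0 < m) (hsep : (X ^ m - 1 : F[X]).Separable) (hmK : (m : K) ≠ 0) (g11 g12 g22 : F[X]) :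
    IsLCDWith
      (Submodule.span (AdjoinRoot (X ^ m - 1 : F[X]))
        {(AdjoinRoot.mk (X ^ m - 1 : F[X]) g11, AdjoinRoot.mk (X ^ m - 1 : F[X]) g12),
          (0, AdjoinRoot.mk (X ^ m - 1 : F[X]) g22)})
      (qcSympInner hm) ↔
    ∀ x : K, x ^ m = 1 → ∀ p q : F[X],
      aeval x⁻¹ g11 * aeval x (p * g12 + q * g22) = aeval x⁻¹ g12 * aeval x (p * g11) →
      aeval x⁻¹ g22 * aeval x (p * g11) = 0 →
      aeval x (p * g11) = 0 ∧ aeval x (p * g12 + q * g22) = 0 := by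
  set N : F[X] := X ^ m - 1 with hN
  have hdual : ∀ v1 v2 : F[X],
      (∀ c ∈ Submodule.span (AdjoinRoot N)
        {(AdjoinRoot.mk N g11, AdjoinRoot.mk N g12), (0, AdjoinRoot.mk N g22)},
        qcSympInner hm c (AdjoinRoot.mk N v1, AdjoinRoot.mk N v2) = 0) ↔
      ∀ x : K, x ^ m = 1 → aeval x⁻¹ g11 * aeval x v2 = aeval x⁻¹ g12 * aeval x v1 ∧
        aeval x⁻¹ g22 * aeval x v1 = 0 := by
    intro v1 v2
    constructor
    · intro h x hx
      refine ⟨(hζ.forall_qcSympInner_mul_eq_zero_iff hm hmK g11 g12 v1 v2).1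
        (fun p => h _ ((mem_span_pair_mk_iff _ _ _ _ _).2
          ⟨p, 0, by rw [zero_mul, add_zero]⟩)) x hx, ?_⟩
      simpa using ((hζ.forall_qcSympInner_mul_eq_zero_iff hm hmK 0 g22 v1 v2).1
        (fun p => h _ ((mem_span_pair_mk_iff _ _ _ _ _).2
          ⟨0, p, by rw [zero_mul, zero_mul, zero_add, mul_zero]⟩)) x hx).symm
    · intro h c hc
      obtain ⟨p, q, rfl⟩ := (mem_span_pair_mk_iff _ _ _ _ _).1 hc
      have := (hζ.forall_qcSympInner_mul_eq_zero_iff hm hmK (p * g11) (p * g12 + q * g22)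
        v1 v2).2 (fun x hx => by
          obtain ⟨ha, hb⟩ := h x hx
          simp only [map_mul, map_add]
          linear_combination aeval x⁻¹ p * ha - aeval x⁻¹ q * hb) 1
      simpa using this
  have hzero : ∀ p : F[X], AdjoinRoot.mk N p = 0 ↔ ∀ x : K, x ^ m = 1 → aeval x p = 0 := by
    intro p
    rw [AdjoinRoot.mk_eq_zero]
    refine ⟨fun h x hx => aeval_eq_zero_of_dvd h (aeval_X_pow_sub_one_eq_zero_iff.2 hx),
      fun h => hsep.dvd_of_forall_aeval (K := K)
        fun x hx => h x (aeval_X_pow_sub_one_eq_zero_iff.1 hx)⟩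
  constructor
  · intro h x hx p q hp1 hp2
    have hxN : aeval x N = 0 := aeval_X_pow_sub_one_eq_zero_iff.2 hx
    have hx0 : x ≠ 0 := by
      rintro rfl
      simp [hm.ne'] at hx
    obtain ⟨e, he⟩ := minpoly.dvd F x hxN
    -- `e` vanishes at every `m`-th root of unity not conjugate to `x`.
    have hex : aeval x e ≠ 0 := by
      have := aeval_ne_zero_of_isCoprime (he ▸ hsep).isCoprime x
      simpa [minpoly.aeval] using this
    have hkill : ∀ P : F[X], aeval x P = 0 → ∀ y : K, y ^ m = 1 →
        aeval y e * aeval y P = 0 := by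
      intro P hP y hy
      rw [← map_mul]
      refine aeval_eq_zero_of_dvd (p := N) ?_ (aeval_X_pow_sub_one_eq_zero_iff.2 hy)
      rw [he, mul_comm]
      exact mul_dvd_mul_left _ (minpoly.dvd F x hP)
    have hrefl : ∀ f : F[X], ∃ f' : F[X], ∀ y : K, y ^ m = 1 → aeval y f' = aeval y⁻¹ f := by
      intro f
      refine ⟨f.comp (X ^ (m - 1)), fun y hy => ?_⟩
      have : y ^ (m - 1) = y⁻¹ := by
        refine eq_inv_of_mul_eq_one_left ?_
        rw [← pow_succ, Nat.sub_add_cancel hm, hy]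
      simp [aeval_comp, this]
    obtain ⟨f11, h11⟩ := hrefl g11
    obtain ⟨f12, h12⟩ := hrefl g12
    obtain ⟨f22, h22⟩ := hrefl g22
    have hv := h (AdjoinRoot.mk N (e * p * g11), AdjoinRoot.mk N (e * p * g12 + e * q * g22))
      ((mem_span_pair_mk_iff _ _ _ _ _).2 ⟨e * p, e * q, rfl⟩)
      ((hdual _ _).2 fun y hy => by
        have k1 := hkill (f11 * (p * g12 + q * g22) - f12 * (p * g11))
          (by rw [map_sub, map_mul, map_mul, h11 x hx, h12 x hx, hp1, sub_self]) y hy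
        have k2 := hkill (f22 * (p * g11)) (by rw [map_mul, h22 x hx, hp2]) y hy
        simp only [map_mul, map_add, map_sub, h11 y hy, h12 y hy, h22 y hy] at k1 k2 ⊢
        exact ⟨by linear_combination k1, by linear_combination k2⟩)
    rw [Prod.mk_eq_zero, hzero, hzero] at hv
    have e1 := hv.1 x hx
    have e2 := hv.2 x hx
    rw [mul_assoc, map_mul] at e1
    rw [mul_assoc, mul_assoc, ← mul_add, map_mul] at e2
    exact ⟨(mul_eq_zero.1 e1).resolve_left hex, (mul_eq_zero.1 e2).resolve_left hex⟩
  · intro h v hv hvd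
    obtain ⟨p, q, rfl⟩ := (mem_span_pair_mk_iff _ _ _ _ _).1 hv
    rw [hdual] at hvd
    rw [Prod.mk_eq_zero, hzero, hzero]
    exact ⟨fun x hx => (h x hx p q (hvd x hx).1 (hvd x hx).2).1,
      fun x hx => (h x hx p q (hvd x hx).1 (hvd x hx).2).2⟩

end RootsOfUnity

/-- Characterization of symplectic LCD quasi-cyclic codes of index 2:
`C = ⟨(g11, g12), (0, g22)⟩` is symplectic LCD iff (I) `g` is self-reciprocal,
(II) `l` is self-reciprocal, (III) `r11` is a nonzero constant, and
(IV) `gcd(r22, g11·ḡ12 - g12·ḡ11) = 1`. -/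
theorem stmt11 (F : Type) [Field F] [Fintype F] [DecidableEq F] (m : ℕ) (hm : 0 < m)
    (hqm : Nat.Coprime (Fintype.card F) m)
    (g11 g12 g22 : F[X])
    (h1 : g11 ∣ X ^ m - 1) (h2 : g22 ∣ X ^ m - 1)
    (h3 : g12.degree < g22.degree) (h4 : g11 * g22 ∣ (X ^ m - 1) * g12)
    (g l g11' g22' r11 t11 r22 t22 : F[X])
    (hg : g = gcd g11 g22) (hl : l = (X ^ m - 1) / lcm g11 g22)
    (h11' : g11' = g11 / g) (h22' : g22' = g22 / g)
    (hr11 : r11 = gcd g11' g11'.reverse) (ht11 : t11 = g11' / r11)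
    (hr22 : r22 = gcd g22' g22'.reverse) (ht22 : t22 = g22' / r22)
    :
    IsLCDWith
      (Submodule.span (AdjoinRoot (X ^ m - 1 : F[X]))
        {(AdjoinRoot.mk (X ^ m - 1 : F[X]) g11, AdjoinRoot.mk (X ^ m - 1 : F[X]) g12), (0, AdjoinRoot.mk (X ^ m - 1 : F[X]) g22)})
      (qcSympInner hm) ↔
    (IsSelfReciprocal g ∧ IsSelfReciprocal l ∧
      (∃ c : F, c ≠ 0 ∧ r11 = Polynomial.C c) ∧
      IsCoprime r22 (g11 * reflect m g12 - g12 * reflect m g11)) := by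
  obtain ⟨K, _, _, _⟩ : ∃ (K : Type) (_ : Field K) (_ : Algebra F K), IsAlgClosed K :=
    ⟨AlgebraicClosure F, inferInstance, inferInstance, inferInstance⟩
  set N : F[X] := X ^ m - 1 with hN
  have hmF : (m : F) ≠ 0 := by
    obtain ⟨p, hp⟩ := CharP.exists F
    intro h0
    have hpm : p ∣ m := (CharP.cast_eq_zero_iff F p m).1 h0
    have hpq : p ∣ Fintype.card F := (CharP.cast_eq_zero_iff F p _).1 (Nat.cast_card_eq_zero F)
    have hp1 : p = 1 := Nat.dvd_one.1 (hqm ▸ Nat.dvd_gcd hpq hpm)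
    exact CharP.char_ne_one F p hp1
  have hmK : (m : K) ≠ 0 := by
    rw [← map_natCast (algebraMap F K)]
    exact (_root_.map_ne_zero _).2 hmF
  have : NeZero (m : K) := ⟨hmK⟩
  obtain ⟨ζ, hζ⟩ := HasEnoughRootsOfUnity.exists_primitiveRoot K m
  have hsep : N.Separable := X_pow_sub_one_separable_iff.2 hmF
  have hcoeff : ∀ p : F[X], p ∣ N → p.coeff 0 ≠ 0 := by
    rintro p ⟨r, hr⟩ hp
    have := congrArg (coeff · 0) hr
    simp [hN, mul_coeff_zero, hp, coeff_X_pow, hm.ne] at this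
  have hroot : ∀ p : F[X], p ∣ N → ∀ x : K, aeval x p = 0 → x ^ m = 1 := fun p hp x hx =>
    aeval_X_pow_sub_one_eq_zero_iff.1 (aeval_eq_zero_of_dvd hp hx)
  have hne : ∀ x : K, x ^ m = 1 → x ≠ 0 := by
    rintro x hx rfl
    simp [hm.ne'] at hx
  have hinv : ∀ x : K, x ^ m = 1 → x⁻¹ ^ m = 1 := fun x hx => by rw [inv_pow, hx, inv_one]
  have hg11 : g11' * g = g11 := by
    rw [h11', mul_comm]
    exact EuclideanDomain.mul_div_cancel' (hg ▸ gcd_ne_zero_of_left (hsep.of_dvd h1).ne_zero)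
      (hg ▸ gcd_dvd_left g11 g22)
  have hg22 : g22' * g = g22 := by
    rw [h22', mul_comm]
    exact EuclideanDomain.mul_div_cancel' (hg ▸ gcd_ne_zero_of_left (hsep.of_dvd h1).ne_zero)
      (hg ▸ gcd_dvd_right g11 g22)
  have hlN : l * lcm g11 g22 = N := by
    rw [hl, mul_comm]
    exact EuclideanDomain.mul_div_cancel'
      (lcm_ne_zero_iff.2 ⟨(hsep.of_dvd h1).ne_zero, (hsep.of_dvd h2).ne_zero⟩) (lcm_dvd h1 h2)
  have hgN : g ∣ N := (Dvd.intro_left _ hg11).trans h1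
  have hlN' : l ∣ N := Dvd.intro _ hlN
  have h11N : g11' ∣ N := (Dvd.intro _ hg11).trans h1
  have h22N : g22' ∣ N := (Dvd.intro _ hg22).trans h2
  -- The roots of all polynomials involved, in terms of the roots of `g11` and `g22`.
  have zg : ∀ x : K, aeval x g = 0 ↔ aeval x g11 = 0 ∧ aeval x g22 = 0 := fun x => by
    rw [hg, aeval_gcd_eq_zero_iff]
  have z11 : ∀ x : K, aeval x g11' = 0 ↔ aeval x g11 = 0 ∧ aeval x g22 ≠ 0 := fun x => by
    rw [Separable.aeval_left_eq_zero_iff (q := g) (hg11 ▸ hsep.of_dvd h1), hg11, Ne, zg]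
    tauto
  have z22 : ∀ x : K, aeval x g22' = 0 ↔ aeval x g11 ≠ 0 ∧ aeval x g22 = 0 := fun x => by
    rw [Separable.aeval_left_eq_zero_iff (q := g) (hg22 ▸ hsep.of_dvd h2), hg22, Ne, zg]
    tauto
  have zl : ∀ x : K, x ^ m = 1 → (aeval x l = 0 ↔ aeval x g11 ≠ 0 ∧ aeval x g22 ≠ 0) := by
    intro x hx
    rw [Separable.aeval_left_eq_zero_iff (q := lcm g11 g22) (hlN ▸ hsep), hlN, Ne,
      aeval_lcm_eq_zero_iff, not_or]
    exact and_iff_right (aeval_X_pow_sub_one_eq_zero_iff.2 hx)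
  have z12 : ∀ x : K, aeval x g11 = 0 → aeval x g22 = 0 → aeval x g12 = 0 := by
    intro x hx1 hx2
    have hgne : g ≠ 0 := (hsep.of_dvd hgN).ne_zero
    have hxg := (zg x).2 ⟨hx1, hx2⟩
    obtain ⟨k, hk⟩ := hgN
    have hdvd : g11' * g22 ∣ k * g12 := by
      rw [← mul_dvd_mul_iff_left hgne]
      convert h4 using 1
      · rw [← hg11]; ring
      · rw [hk]; ring
    have := aeval_eq_zero_of_dvd ((dvd_mul_left g22 g11').trans hdvd) hx2
    have hkx := aeval_ne_zero_of_isCoprime (hk ▸ hsep).isCoprime x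
    rw [map_mul, mul_eq_zero] at this
    tauto
  have hNdeg : N.natDegree = m := by
    simpa using natDegree_X_pow_sub_C (n := m) (r := (1 : F))
  have hdeg : ∀ p : F[X], p ∣ N → p.natDegree ≤ m := fun p hp =>
    hNdeg ▸ natDegree_le_of_dvd hp hsep.ne_zero
  have e11 : ∀ x : K, x ^ m = 1 → aeval x (reflect m g11) = aeval x⁻¹ g11 := fun x hx => by
    rw [aeval_reflect_eq (hdeg _ h1) (hne x hx), hx, one_mul]
  have e12 : ∀ x : K, x ^ m = 1 → aeval x (reflect m g12) = aeval x⁻¹ g12 := fun x hx => by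
    rw [aeval_reflect_eq ((natDegree_le_natDegree h3.le).trans (hdeg _ h2)) (hne x hx), hx,
      one_mul]
  have zr11 : ∀ x : K, aeval x r11 = 0 ↔ aeval x g11' = 0 ∧ aeval x⁻¹ g11' = 0 := fun x => by
    rw [hr11, aeval_gcd_eq_zero_iff]
    exact and_congr_right fun hx => aeval_reverse_eq_zero_iff (hne x (hroot _ h11N x hx))
  have zr22 : ∀ x : K, aeval x r22 = 0 ↔ aeval x g22' = 0 ∧ aeval x⁻¹ g22' = 0 := fun x => by
    rw [hr22, aeval_gcd_eq_zero_iff]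
    exact and_congr_right fun hx => aeval_reverse_eq_zero_iff (hne x (hroot _ h22N x hx))
  rw [isLCDWith_qcSympInner_iff_forall_aeval hζ hm hsep hmK,
    isSelfReciprocal_iff_forall_aeval (K := K) (hsep.of_dvd hgN) (hcoeff _ hgN),
    isSelfReciprocal_iff_forall_aeval (K := K) (hsep.of_dvd hlN') (hcoeff _ hlN'),
    exists_eq_C_iff_forall_aeval_ne_zero (K := K), isCoprime_iff_aeval_ne_zero_of_isAlgClosed F K]
  constructor
  · intro h
    have hI : ∀ x : K, aeval x g = 0 → aeval x⁻¹ g = 0 := by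
      intro x hx
      have hxm := hroot _ hgN x hx
      obtain ⟨a1, a2⟩ := (zg x).1 hx
      have a3 := z12 x a1 a2
      have b1 := (h x⁻¹ (hinv x hxm) 1 0 (by simp [a1, a3]) (by simp [a2])).1
      have b2 := (h x⁻¹ (hinv x hxm) 0 1 (by simp [a1]) (by simp)).2
      exact (zg _).2 ⟨by simpa using b1, by simpa using b2⟩
    refine ⟨hI, ?_, ?_, ?_⟩
    · intro x hx
      have hxm := hroot _ hlN' x hx
      obtain ⟨a1, a2⟩ := (zl x hxm).1 hx
      rw [zl _ (hinv x hxm)]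
      have c1 : aeval x⁻¹ g11 ≠ 0 := fun c1 => a2 <| by
        simpa using (h x hxm 0 1 (by simp [c1]) (by simp)).2
      refine ⟨c1, fun c2 => ?_⟩
      have := (h x hxm (g22 * reflect m g11) (g11 * reflect m g12 - g12 * reflect m g11)
        (by simp only [map_mul, map_add, map_sub, e11 x hxm, e12 x hxm]; ring)
        (by simp [c2])).1
      simp only [map_mul, e11 x hxm, mul_eq_zero] at this
      tauto
    · intro x hx
      obtain ⟨a, b⟩ := (zr11 x).1 hx
      have hxm := hroot _ h11N x a
      apply ((z11 x).1 a).2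
      simpa using (h x hxm 0 1 (by simp [((z11 _).1 b).1]) (by simp)).2
    · intro x
      by_contra! hx
      obtain ⟨a, b⟩ := (zr22 x).1 hx.1
      have hxm := hroot _ h22N x a
      have hD := hx.2
      simp only [map_mul, map_sub, e11 x hxm, e12 x hxm] at hD
      apply ((z22 x).1 a).1
      simpa using (h x hxm 1 0 (by simp; linear_combination -hD)
        (by simp [((z22 _).1 b).2])).1
  · rintro ⟨hI, hII, hIII, hIV⟩ x hx p q hv1 hv2
    have I := hI x⁻¹
    have I' := hI x
    have II := hII x
    have III := hIII x
    have IV := hIV x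
    simp only [inv_inv, zg, zl x hx, zl _ (hinv x hx), Ne, zr11, zr22, z11, z22] at I I' II III IV
    simp only [map_mul, map_sub, map_add, e11 x hx, e12 x hx] at IV hv1 hv2 ⊢
    have h12x := z12 x
    by_cases c1 : aeval x⁻¹ g11 = 0
    · by_cases c2 : aeval x⁻¹ g22 = 0
      · obtain ⟨a1, a2⟩ := I ⟨c1, c2⟩
        simp [a1, a2, h12x a1 a2]
      · have w1 := (mul_eq_zero.1 hv2).resolve_left c2
        by_cases a1 : aeval x g11 = 0
        · exact absurd ⟨⟨a1, fun a2 => c2 (I' ⟨a1, a2⟩).2⟩, c1, c2⟩ III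
        · have a2 : aeval x g22 = 0 := by_contra fun a2 => (II ⟨a1, a2⟩).1 c1
          have hp := (mul_eq_zero.1 w1).resolve_right a1
          simp [hp, a2]
    · have key : aeval x p * aeval x g11 = 0 → aeval x p * aeval x g11 = 0 ∧
          aeval x p * aeval x g12 + aeval x q * aeval x g22 = 0 := fun w1 => by
        rw [w1, mul_zero] at hv1
        exact ⟨w1, (mul_eq_zero.1 hv1).resolve_left c1⟩
      apply key
      by_cases c2 : aeval x⁻¹ g22 = 0
      · by_cases a1 : aeval x g11 = 0
        · rw [a1, mul_zero]
        · have a2 : aeval x g22 = 0 := by_contra fun a2 => (II ⟨a1, a2⟩).2 c2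
          have hD : ¬(aeval x g11 * aeval x⁻¹ g12 - aeval x g12 * aeval x⁻¹ g11 = 0) :=
            IV.resolve_left fun h => h ⟨⟨a1, a2⟩, c1, c2⟩
          rw [a2, mul_zero, add_zero] at hv1
          have hp : aeval x p * (aeval x g11 * aeval x⁻¹ g12 - aeval x g12 * aeval x⁻¹ g11) = 0 := by
            linear_combination -hv1
          rw [(mul_eq_zero.1 hp).resolve_right hD, zero_mul]
      · exact (mul_eq_zero.1 hv2).resolve_left c2
end
end
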